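/- Let n ≥ 1, let p_1, …, p_n ≥ 0 with p_1 + … + p_n = 1 and α_1, …, α_n ∈ [0,1), and set R(Y) = Σ_{i=1}^n p_i·AVaR_{α_i}(Y). If β ∈ [0,1) satisfies β ≥ 1 − (1 − max_{i} α_i)·Σ_{i=1}^n p_i/(1−α_i), then for every integrable random variable Y the higher order risk measure collapses to an average value-at-risk: inf_{t ∈ ℝ} ( t + (1−β)^{-1}·R((Y−t)₊) ) = AVaR_{1−(1−α̃)(1−β)}(Y), where α̃ = ( Σ_{i=1}^n p_i·α_i/(1−α_i) ) / ( Σ_{i=1}^n p_i/(1−α_i) ). -/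

import Mathlib

open MeasureTheory Set

/-- Cumulative distribution function `F_Y(x) = P(Y ≤ x)`. -/
noncomputable def cdfR {Ω : Type*} [MeasurableSpace Ω] (P : Measure Ω) (Y : Ω → ℝ)
    (x : ℝ) : ℝ :=
  (P {ω | Y ω ≤ x}).toReal

/-- Quantile function `F_Y⁻¹(u) = inf {x : F_Y(x) ≥ u}`. -/
noncomputable def quantR {Ω : Type*} [MeasurableSpace Ω] (P : Measure Ω) (Y : Ω → ℝ)
    (u : ℝ) : ℝ :=
  sInf {x : ℝ | u ≤ cdfR P Y x}

/-- Average value-at-risk `AVaR_α(Y) = (1-α)⁻¹ ∫_α^1 F_Y⁻¹(u) du`. -/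
noncomputable def avarR {Ω : Type*} [MeasurableSpace Ω] (P : Measure Ω) (α : ℝ)
    (Y : Ω → ℝ) : ℝ :=
  (1 - α)⁻¹ * ∫ u in α..1, quantR P Y u

lemma aux_max (f : ℝ → ℝ) (c a b : ℝ) (hf : IntervalIntegrable f volume a b) :
    IntervalIntegrable (fun u => max (f u) c) volume a b := by
  have hc : IntervalIntegrable (fun _ : ℝ => c) volume a b := intervalIntegrable_const
  rw [intervalIntegrable_iff] at *
  exact Integrable.sup hf hc

lemma aux_cdf {Ω : Type*} [MeasurableSpace Ω] (P : Measure Ω) [IsProbabilityMeasure P]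
    (Y : Ω → ℝ) (hY : AEMeasurable Y P) (x : ℝ) :
    cdfR P Y x = ProbabilityTheory.cdf (P.map Y) x := by
  haveI : IsProbabilityMeasure (P.map Y) := Measure.isProbabilityMeasure_map hY
  rw [ProbabilityTheory.cdf_eq_real, cdfR, measureReal_def,
    Measure.map_apply_of_aemeasurable hY measurableSet_Iic]
  rfl

lemma aux_galois {Ω : Type*} [MeasurableSpace Ω] (P : Measure Ω) [IsProbabilityMeasure P]
    (Y : Ω → ℝ) (hY : AEMeasurable Y P) (u : ℝ) (h0 : 0 < u) (h1 : u < 1) :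
    {x : ℝ | u ≤ cdfR P Y x} = Ici (quantR P Y u) := by
  have hF := aux_cdf P Y hY
  have hmono := ProbabilityTheory.monotone_cdf (P.map Y)
  have hne : {x : ℝ | u ≤ cdfR P Y x}.Nonempty := by
    obtain ⟨x, hx⟩ := ((ProbabilityTheory.tendsto_cdf_atTop (P.map Y)).eventually
      (lt_mem_nhds h1)).exists
    exact ⟨x, by simpa [hF] using hx.le⟩
  have hbd : BddBelow {x : ℝ | u ≤ cdfR P Y x} := by
    obtain ⟨x, hx⟩ := ((ProbabilityTheory.tendsto_cdf_atBot (P.map Y)).eventually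
      (gt_mem_nhds h0)).exists
    refine ⟨x, fun y hy => ?_⟩
    by_contra! hlt
    have := hmono hlt.le
    simp only [mem_setOf_eq, hF] at hy
    linarith
  ext x
  constructor
  · intro hx
    exact csInf_le hbd hx
  · intro hx
    have key : u ≤ ProbabilityTheory.cdf (P.map Y) (quantR P Y u) := by
      have hr := (ProbabilityTheory.cdf (P.map Y)).right_continuous (quantR P Y u)
      have hr' := hr.mono_left (nhdsWithin_mono _ (Ioi_subset_Ici_self))
      refine ge_of_tendsto hr' ?_
      filter_upwards [self_mem_nhdsWithin] with z hz
      obtain ⟨y, hy, hyz⟩ := exists_lt_of_csInf_lt hne hz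
      simp only [mem_setOf_eq, hF] at hy
      exact hy.trans (hmono hyz.le)
    simp only [mem_setOf_eq, hF]
    exact key.trans (hmono hx)

lemma aux_pos {Ω : Type*} [MeasurableSpace Ω] (P : Measure Ω) [IsProbabilityMeasure P]
    (Y : Ω → ℝ) (hY : AEMeasurable Y P) (t u : ℝ) (h0 : 0 < u) (h1 : u < 1) :
    quantR P (fun ω => max (Y ω - t) 0) u = max (quantR P Y u - t) 0 := by
  have hg := aux_galois P Y hY u h0 h1
  have : {x : ℝ | u ≤ cdfR P (fun ω => max (Y ω - t) 0) x} = Ici (max (quantR P Y u - t) 0) := by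
    ext x
    have hx' : u ≤ cdfR P Y (x + t) ↔ quantR P Y u ≤ x + t := by
      have := Set.ext_iff.1 hg (x + t)
      simpa using this
    rw [mem_Ici, max_le_iff, sub_le_iff_le_add, ← hx', mem_setOf_eq]
    by_cases hx : 0 ≤ x
    · have : {ω | max (Y ω - t) 0 ≤ x} = {ω | Y ω ≤ x + t} := by
        ext ω; simp [hx]
      simp [cdfR, this, hx]
    · have : {ω | max (Y ω - t) 0 ≤ x} = ∅ := by
        ext ω; simp [hx]
      simp [cdfR, this, hx, h0]
  rw [quantR, this, csInf_Ici]

lemma aux_mono {Ω : Type*} [MeasurableSpace Ω] (P : Measure Ω) [IsProbabilityMeasure P]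
    (Y : Ω → ℝ) (hY : AEMeasurable Y P) : MonotoneOn (quantR P Y) (Ioo 0 1) := by
  intro a ha b hb hab
  have hA := aux_galois P Y hY a ha.1 ha.2
  have hB := aux_galois P Y hY b hb.1 hb.2
  have : quantR P Y b ∈ {x : ℝ | b ≤ cdfR P Y x} := by rw [hB]; exact self_mem_Ici
  have h2 : quantR P Y b ∈ {x : ℝ | a ≤ cdfR P Y x} := le_trans hab this
  rw [hA] at h2
  exact h2

lemma aux_int {Ω : Type*} [MeasurableSpace Ω] (P : Measure Ω) [IsProbabilityMeasure P]
    (Y : Ω → ℝ) (hY : Integrable Y P) : IntegrableOn (quantR P Y) (Ioo 0 1) volume := by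
  have hm : AEMeasurable (quantR P Y) (volume.restrict (Ioo 0 1)) :=
    aemeasurable_restrict_of_monotoneOn measurableSet_Ioo (aux_mono P Y hY.aemeasurable)
  haveI : IsProbabilityMeasure (P.map Y) := Measure.isProbabilityMeasure_map hY.aemeasurable
  haveI : IsFiniteMeasure (volume.restrict (Ioo (0:ℝ) 1)) := ⟨by simp⟩
  have hmap : (volume.restrict (Ioo (0:ℝ) 1)).map (quantR P Y) = P.map Y := by
    refine Measure.ext_of_Iic _ _ fun x => ?_
    rw [Measure.map_apply_of_aemeasurable hm measurableSet_Iic,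
      Measure.map_apply_of_aemeasurable hY.aemeasurable measurableSet_Iic,
      Measure.restrict_apply' measurableSet_Ioo]
    have e : quantR P Y ⁻¹' Iic x ∩ Ioo 0 1 = Iic (cdfR P Y x) ∩ Ioo 0 1 := by
      ext u
      simp only [mem_inter_iff, mem_preimage, mem_Iic]
      refine and_congr_left fun hu => ?_
      have := Set.ext_iff.1 (aux_galois P Y hY.aemeasurable u hu.1 hu.2) x
      exact this.symm
    have c0 : 0 ≤ cdfR P Y x := ENNReal.toReal_nonneg
    have c1 : cdfR P Y x ≤ 1 := by
      rw [aux_cdf P Y hY.aemeasurable]; exact ProbabilityTheory.cdf_le_one _ _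
    have e2 : volume (Iic (cdfR P Y x) ∩ Ioo 0 1) = ENNReal.ofReal (cdfR P Y x) := by
      apply le_antisymm
      · calc _ ≤ volume (Ioc 0 (cdfR P Y x)) := measure_mono fun u hu => ⟨hu.2.1, hu.1⟩
          _ = _ := by simp
      · calc _ = volume (Ioo 0 (cdfR P Y x)) := by simp
          _ ≤ volume (Iic (cdfR P Y x) ∩ Ioo 0 1) :=
            measure_mono fun u hu => ⟨hu.2.le, hu.1, hu.2.trans_le c1⟩
    rw [e, e2, cdfR, ENNReal.ofReal_toReal (measure_ne_top _ _)]
    rfl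
  have hid : Integrable (id : ℝ → ℝ) (P.map Y) := by
    rw [integrable_map_measure aestronglyMeasurable_id hY.aemeasurable]
    exact hY
  rw [← hmap, integrable_map_measure aestronglyMeasurable_id hm] at hid
  exact hid

theorem aux_main (q : ℝ → ℝ) (hq : MonotoneOn q (Ioo 0 1))
    (hi : IntervalIntegrable q volume 0 1) (n : ℕ) (α : Fin n → ℝ)
    (γ : ℝ) (hα : ∀ i, α i ∈ Set.Ico (0 : ℝ) 1) (h0 : 0 ≤ γ) (h1 : γ < 1) (hle : ∀ i, α i ≤ γ)
    (ε : ℝ) (hε : 0 < ε) :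
    ∃ t, ∀ i, ∫ u in α i..1, max (q u - t) 0 ≤ (∫ u in γ..1, q u) - (1 - γ) * t + ε := by
  have hsub : ∀ a b, 0 ≤ a → a ≤ b → b ≤ 1 → IntervalIntegrable q volume a b := by
    intro a b ha hab hb
    refine hi.mono_set ?_
    rw [uIcc_of_le hab, uIcc_of_le zero_le_one]
    exact Icc_subset_Icc ha hb
  rcases h0.eq_or_lt with rfl | hpos
  · have hz : ∀ i, α i = 0 := fun i => le_antisymm (hle i) (hα i).1
    have hT : Filter.Tendsto (fun k : ℕ => ∫ u in (0:ℝ)..1, max (q u) (-(k:ℝ))) Filter.atTop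
        (nhds (∫ u in (0:ℝ)..1, q u)) := by
      refine intervalIntegral.tendsto_integral_filter_of_dominated_convergence (fun u => |q u|)
        ?_ ?_ hi.abs ?_
      · filter_upwards with k
        exact (hi.def'.aestronglyMeasurable).sup aestronglyMeasurable_const
      · filter_upwards with k
        filter_upwards with u _
        rw [Real.norm_eq_abs, abs_le]
        have hk : (0:ℝ) ≤ k := k.cast_nonneg
        exact ⟨(neg_abs_le _).trans (le_max_left _ _),
          max_le (le_abs_self _) (by linarith [abs_nonneg (q u)])⟩
      · filter_upwards with u _
        refine tendsto_const_nhds.congr' ?_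
        obtain ⟨N, hN⟩ := exists_nat_ge (-(q u))
        filter_upwards [Filter.eventually_ge_atTop N] with k hk
        have : (N:ℝ) ≤ k := by exact_mod_cast hk
        rw [max_eq_left]; linarith
    obtain ⟨k, hk⟩ := (hT.eventually (gt_mem_nhds (lt_add_of_pos_right _ hε))).exists
    refine ⟨-k, fun i => ?_⟩
    rw [hz i]
    have e : ∀ u, max (q u - -(k:ℝ)) 0 = max (q u) (-(k:ℝ)) - -(k:ℝ) := by
      intro u; rw [← max_sub_sub_right, sub_self]
    simp only [e]
    rw [intervalIntegral.integral_sub (aux_max q _ 0 1 hi) intervalIntegrable_const]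
    simp
    linarith
  · refine ⟨q γ, fun i => ?_⟩
    have hm : ∀ a b, 0 ≤ a → a ≤ b → b ≤ 1 →
        IntervalIntegrable (fun u => max (q u - q γ) 0) volume a b := fun a b ha hab hb =>
      aux_max (fun u => q u - _) 0 a b ((hsub a b ha hab hb).sub intervalIntegrable_const)
    rw [← intervalIntegral.integral_add_adjacent_intervals
      (hm (α i) γ (hα i).1 (hle i) h1.le) (hm γ 1 h0 h1.le le_rfl)]
    have e1 : ∫ u in α i..γ, max (q u - q γ) 0 = 0 := by
      rw [intervalIntegral.integral_of_le (hle i)]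
      refine setIntegral_eq_zero_of_forall_eq_zero fun u hu => ?_
      have := hq ⟨(hα i).1.trans_lt hu.1, hu.2.trans_lt h1⟩ ⟨hpos, h1⟩ hu.2
      exact max_eq_right (by linarith)
    have e2 : ∫ u in γ..1, max (q u - q γ) 0 = ∫ u in γ..1, (q u - q γ) := by
      rw [intervalIntegral.integral_of_le h1.le, intervalIntegral.integral_of_le h1.le,
        integral_Ioc_eq_integral_Ioo, integral_Ioc_eq_integral_Ioo]
      refine setIntegral_congr_fun measurableSet_Ioo fun u hu => ?_
      have := hq ⟨hpos, h1⟩ ⟨hpos.trans hu.1, hu.2⟩ hu.1.le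
      exact max_eq_left (by linarith)
    rw [e1, e2, intervalIntegral.integral_sub (hsub γ 1 h0 h1.le le_rfl) intervalIntegrable_const]
    simp
    linarith

theorem stmt8 {Ω : Type*} [MeasurableSpace Ω] (P : Measure Ω) [IsProbabilityMeasure P]
    (n : ℕ) (hn : 1 ≤ n) (p α : Fin n → ℝ)
    (hp : ∀ i, 0 ≤ p i) (hp1 : ∑ i, p i = 1) (hα : ∀ i, α i ∈ Set.Ico (0 : ℝ) 1)
    (β : ℝ) (hβ : β ∈ Set.Ico (0 : ℝ) 1)
    (hβbig : 1 - (1 - ⨆ i, α i) * ∑ i, p i / (1 - α i) ≤ β)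
    (Y : Ω → ℝ) (hY : Integrable Y P) :
    (⨅ t : ℝ, t + (1 - β)⁻¹ * ∑ i, p i * avarR P (α i) (fun ω => max (Y ω - t) 0)) =
      avarR P
        (1 - (1 - (∑ i, p i * α i / (1 - α i)) / (∑ i, p i / (1 - α i))) * (1 - β)) Y := by
  have hpos : ∀ i, 0 < 1 - α i := fun i => by linarith [(hα i).2]
  obtain ⟨S, hS⟩ : ∃ S, S = ∑ i, p i / (1 - α i) := ⟨_, rfl⟩
  have hnum : ∑ i, p i * α i / (1 - α i) = S - 1 := by
    have : S - 1 = ∑ i, p i / (1 - α i) - ∑ i, p i := by rw [hp1, hS]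
    rw [this, ← Finset.sum_sub_distrib]
    refine Finset.sum_congr rfl fun i _ => ?_
    have := (hpos i).ne'
    field_simp
    ring
  have hS1 : 1 ≤ S := by
    rw [hS]
    refine hp1.symm.le.trans ?_
    refine Finset.sum_le_sum fun i _ => ?_
    rw [le_div_iff₀ (hpos i)]
    nlinarith [hp i, (hα i).1]
  have hS0 : 0 < S := by linarith
  have hb : 0 < 1 - β := by linarith [hβ.2]
  rw [hnum, ← hS]
  rw [← hS] at hβbig
  obtain ⟨γ, hγ⟩ : ∃ γ, γ = 1 - (1 - (S - 1) / S) * (1 - β) := ⟨_, rfl⟩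
  have hγ' : 1 - γ = (1 - β) / S := by rw [hγ]; field_simp; ring
  have hγ1 : 0 < 1 - γ := by rw [hγ']; positivity
  have hγ0 : 0 ≤ γ := by
    have : (1 - β) / S ≤ 1 := by rw [div_le_one hS0]; linarith [hβ.1]
    linarith
  have hle : ∀ i, α i ≤ γ := by
    intro i
    have h1 : α i ≤ ⨆ i, α i := le_ciSup (Set.finite_range α).bddAbove i
    have h2 : (1 - β) / S ≤ 1 - ⨆ i, α i := by rw [div_le_iff₀ hS0]; linarith
    linarith
  have hSγ : (1 - β)⁻¹ * S = (1 - γ)⁻¹ := by rw [hγ', inv_div]; field_simp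
  rw [← hγ]
  obtain ⟨q, hqdef⟩ : ∃ q, q = quantR P Y := ⟨_, rfl⟩
  have hq : MonotoneOn q (Ioo 0 1) := hqdef ▸ aux_mono P Y hY.aemeasurable
  have hi : IntervalIntegrable q volume 0 1 := by
    rw [intervalIntegrable_iff_integrableOn_Ioo_of_le zero_le_one, hqdef]
    exact aux_int P Y hY
  have hsub : ∀ a b, 0 ≤ a → a ≤ b → b ≤ 1 → IntervalIntegrable q volume a b := by
    intro a b ha hab hb
    refine hi.mono_set ?_
    rw [uIcc_of_le hab, uIcc_of_le zero_le_one]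
    exact Icc_subset_Icc ha hb
  have hm : ∀ t a b, 0 ≤ a → a ≤ b → b ≤ 1 →
      IntervalIntegrable (fun u => max (q u - t) 0) volume a b := fun t a b ha hab hb =>
    aux_max (fun u => q u - _) 0 a b ((hsub a b ha hab hb).sub intervalIntegrable_const)
  have hav : ∀ t i, avarR P (α i) (fun ω => max (Y ω - t) 0) =
      (1 - α i)⁻¹ * ∫ u in α i..1, max (q u - t) 0 := by
    intro t i
    rw [avarR, intervalIntegral.integral_of_le (hα i).2.le,
      intervalIntegral.integral_of_le (hα i).2.le,
      integral_Ioc_eq_integral_Ioo, integral_Ioc_eq_integral_Ioo]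
    congr 1
    refine setIntegral_congr_fun measurableSet_Ioo fun u hu => ?_
    rw [hqdef]
    exact aux_pos P Y hY.aemeasurable t u ((hα i).1.trans_lt hu.1) hu.2
  have hsum : ∀ c : ℝ, ∑ i, p i * ((1 - α i)⁻¹ * c) = S * c := by
    intro c
    rw [hS, Finset.sum_mul]
    exact Finset.sum_congr rfl fun i _ => by rw [div_eq_mul_inv]; ring
  have hfin : avarR P γ Y = (1 - γ)⁻¹ * ∫ u in γ..1, q u := by rw [hqdef]; rfl
  simp only [hav]
  rw [hfin]
  obtain ⟨I, hI⟩ : ∃ I, I = ∫ u in γ..1, q u := ⟨_, rfl⟩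
  have hval : ∀ t e : ℝ, t + (1 - β)⁻¹ * (S * (I - (1 - γ) * t + e)) =
      (1 - γ)⁻¹ * I + (1 - γ)⁻¹ * e := by
    intro t e
    rw [← mul_assoc, hSγ]
    field_simp
    ring
  have hlow : ∀ t, (1 - γ)⁻¹ * I ≤
      t + (1 - β)⁻¹ * ∑ i, p i * ((1 - α i)⁻¹ * ∫ u in α i..1, max (q u - t) 0) := by
    intro t
    have h := hval t 0
    rw [mul_zero, add_zero, add_zero] at h
    rw [← h, ← hsum]
    gcongr with i _
    · exact hp i
    · exact inv_nonneg.2 (hpos i).le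
    · rw [← intervalIntegral.integral_add_adjacent_intervals
        (hm t (α i) γ (hα i).1 (hle i) (by linarith)) (hm t γ 1 hγ0 (by linarith) le_rfl)]
      have e1 : 0 ≤ ∫ u in α i..γ, max (q u - t) 0 :=
        intervalIntegral.integral_nonneg (hle i) fun u _ => le_max_right _ _
      have e2 : ∫ u in γ..1, (q u - t) ≤ ∫ u in γ..1, max (q u - t) 0 :=
        intervalIntegral.integral_mono_on (by linarith)
          ((hsub γ 1 hγ0 (by linarith) le_rfl).sub intervalIntegrable_const)
          (hm t γ 1 hγ0 (by linarith) le_rfl) fun u _ => le_max_left _ _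
      rw [intervalIntegral.integral_sub (hsub γ 1 hγ0 (by linarith) le_rfl)
        intervalIntegrable_const, intervalIntegral.integral_const, smul_eq_mul, ← hI] at e2
      linarith
  rw [← hI]
  apply le_antisymm
  · refine le_of_forall_pos_le_add fun ε hε => ?_
    obtain ⟨t, ht⟩ := aux_main q hq hi n α γ hα hγ0 (by linarith) hle ((1 - γ) * ε) (by positivity)
    refine (ciInf_le ⟨(1 - γ)⁻¹ * I, ?_⟩ t).trans ?_
    · rintro _ ⟨s, rfl⟩
      exact hlow s
    · have h := hval t ((1 - γ) * ε)
      rw [inv_mul_cancel_left₀ hγ1.ne'] at h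
      rw [← h, ← hsum]
      gcongr with i _
      · exact hp i
      · exact inv_nonneg.2 (hpos i).le
      · rw [hI]; exact ht i
  · exact le_ciInf hlow
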